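/- arXiv:1903.07106 — 4 statements merged into one kernel-verified Lean document; each statement's English description precedes it below -/
import Mathlib

section
/- Let p ≥ 1 be an integer, let μ > 0 and D ≥ 0, and let f : ℝ^p → ℝ be convex and D-Lipschitz. Then for every x ∈ ℝ^p, f(x) ≤ f_μ(x) ≤ f(x) + √p · μ · D, where f_μ is the Gaussian smoothing of f. -/
open MeasureTheory Real

/-- The standard Gaussian measure on `ℝ^p`: the measure with density
`(2π)^(-p/2) exp(-‖ξ‖²/2)` with respect to Lebesgue measure. -/
noncomputable def stdGaussian (p : ℕ) : Measure (EuclideanSpace ℝ (Fin p)) :=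
  volume.withDensity fun ξ =>
    ENNReal.ofReal ((2 * π) ^ (-(p : ℝ) / 2) * Real.exp (-‖ξ‖ ^ 2 / 2))

lemma pi_gaussian_eq (p : ℕ) :
    Measure.pi (fun _ : Fin p => ProbabilityTheory.gaussianReal 0 1) =
      (volume : Measure (Fin p → ℝ)).withDensity
        (fun x => ∏ i, ProbabilityTheory.gaussianPDF 0 1 (x i)) := by
  refine Measure.pi_eq ?_
  intro s hs
  rw [withDensity_apply _ (MeasurableSet.univ_pi hs), volume_pi, Measure.restrict_pi_pi]
  simp_rw [ProbabilityTheory.gaussianPDF]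
  have h1 : ∀ x : Fin p → ℝ, ∏ i, ENNReal.ofReal (ProbabilityTheory.gaussianPDFReal 0 1 (x i)) =
      ENNReal.ofReal (∏ i, ProbabilityTheory.gaussianPDFReal 0 1 (x i)) := fun x =>
    (ENNReal.ofReal_prod_of_nonneg
      (fun i _ => ProbabilityTheory.gaussianPDFReal_nonneg 0 1 (x i))).symm
  simp_rw [h1]
  rw [← ofReal_integral_eq_lintegral_ofReal]
  · rw [integral_fintype_prod_eq_prod
      (f := fun (_ : Fin p) (y : ℝ) => ProbabilityTheory.gaussianPDFReal 0 1 y),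
      ENNReal.ofReal_prod_of_nonneg]
    · refine Finset.prod_congr rfl fun i _ => ?_
      rw [ProbabilityTheory.gaussianReal_apply_eq_integral 0 one_ne_zero]
    · intro i _
      exact integral_nonneg (fun y => ProbabilityTheory.gaussianPDFReal_nonneg 0 1 y)
  · exact Integrable.fintype_prod
      (f := fun (_ : Fin p) (y : ℝ) => ProbabilityTheory.gaussianPDFReal 0 1 y)
      (fun i => (ProbabilityTheory.integrable_gaussianPDFReal 0 1).integrableOn)
  · exact Filter.Eventually.of_forall fun x =>
      Finset.prod_nonneg fun i _ => ProbabilityTheory.gaussianPDFReal_nonneg 0 1 (x i)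

lemma density_eq (p : ℕ) (x : Fin p → ℝ) :
    ENNReal.ofReal ((2 * π) ^ (-(p : ℝ) / 2) * Real.exp (-‖WithLp.toLp 2 x‖ ^ 2 / 2)) =
      ∏ i, ProbabilityTheory.gaussianPDF 0 1 (x i) := by
  simp_rw [ProbabilityTheory.gaussianPDF]
  rw [← ENNReal.ofReal_prod_of_nonneg
      (fun i _ => ProbabilityTheory.gaussianPDFReal_nonneg 0 1 (x i))]
  congr 1
  simp only [ProbabilityTheory.gaussianPDFReal, NNReal.coe_one, mul_one, sub_zero]
  rw [Finset.prod_mul_distrib, ← Real.exp_sum, EuclideanSpace.real_norm_sq_eq]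
  congr 1
  · rw [Finset.prod_const, Finset.card_univ, Fintype.card_fin, Real.sqrt_eq_rpow,
      ← Real.rpow_neg (by positivity), ← Real.rpow_natCast, ← Real.rpow_mul (by positivity)]
    congr 1
    ring
  · congr 1
    rw [← Finset.sum_div, Finset.sum_neg_distrib]

lemma stdGaussian_eq (p : ℕ) :
    stdGaussian p = ProbabilityTheory.stdGaussian (EuclideanSpace ℝ (Fin p)) := by
  rw [← ProbabilityTheory.map_pi_eq_stdGaussian, pi_gaussian_eq]
  ext s hs
  have hm : Measurable (WithLp.toLp 2 : (Fin p → ℝ) → EuclideanSpace ℝ (Fin p)) := by fun_prop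
  rw [Measure.map_apply hm hs, withDensity_apply _ (hm hs), stdGaussian, withDensity_apply _ hs,
    ← (PiLp.volume_preserving_toLp (Fin p)).setLIntegral_comp_preimage hs (by fun_prop)]
  simp_rw [density_eq]

lemma integral_norm_sq (p : ℕ) :
    ∫ ξ, ‖ξ‖ ^ 2 ∂(ProbabilityTheory.stdGaussian (EuclideanSpace ℝ (Fin p))) = p := by
  have hm : Measurable (WithLp.toLp 2 : (Fin p → ℝ) → EuclideanSpace ℝ (Fin p)) := by fun_prop
  have h2 : Integrable (fun y : ℝ => y ^ 2) (ProbabilityTheory.gaussianReal 0 1) :=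
    (ProbabilityTheory.memLp_id_gaussianReal 2).integrable_sq
  have h3 : ∫ y, y ^ 2 ∂(ProbabilityTheory.gaussianReal 0 1) = 1 := by
    have := ProbabilityTheory.variance_id_gaussianReal (μ := 0) (v := 1)
    rw [ProbabilityTheory.variance_of_integral_eq_zero (by fun_prop) (by simp)] at this
    simpa using this
  rw [← ProbabilityTheory.map_pi_eq_stdGaussian, integral_map hm.aemeasurable (by fun_prop)]
  simp_rw [EuclideanSpace.real_norm_sq_eq]
  rw [integral_finsetSum _ (fun i _ => integrable_comp_eval
    (μ := fun _ : Fin p => ProbabilityTheory.gaussianReal 0 1) h2)]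
  have : ∀ i : Fin p, ∫ x, (x i) ^ 2
      ∂(Measure.pi (fun _ : Fin p => ProbabilityTheory.gaussianReal 0 1)) = 1 := fun i => by
    rw [integral_comp_eval (μ := fun _ : Fin p => ProbabilityTheory.gaussianReal 0 1)
      (f := fun y : ℝ => y ^ 2) h2.aestronglyMeasurable, h3]
  simp [this]

lemma integral_norm_le (p : ℕ) :
    ∫ ξ, ‖ξ‖ ∂(ProbabilityTheory.stdGaussian (EuclideanSpace ℝ (Fin p))) ≤ Real.sqrt p := by
  have h := ProbabilityTheory.variance_nonneg (fun ξ => ‖ξ‖)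
    (ProbabilityTheory.stdGaussian (EuclideanSpace ℝ (Fin p)))
  rw [ProbabilityTheory.variance_eq_sub (X := fun ξ => ‖ξ‖)
    ProbabilityTheory.IsGaussian.memLp_two_id.norm] at h
  have h2 := integral_norm_sq p
  apply Real.le_sqrt_of_sq_le
  simp only [Pi.pow_apply, id] at h
  linarith

theorem gaussian_smoothing_bounds (p : ℕ) (hp : 1 ≤ p) (μ D : ℝ) (hμ : 0 < μ) (hD : 0 ≤ D)
    (f : EuclideanSpace ℝ (Fin p) → ℝ)
    (hconv : ConvexOn ℝ Set.univ f) (hlip : LipschitzWith D.toNNReal f)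
    (x : EuclideanSpace ℝ (Fin p)) :
    f x ≤ ∫ ξ, f (x + μ • ξ) ∂(stdGaussian p) ∧
      ∫ ξ, f (x + μ • ξ) ∂(stdGaussian p) ≤ f x + Real.sqrt p * μ * D := by
  rw [stdGaussian_eq]
  set P := ProbabilityTheory.stdGaussian (EuclideanSpace ℝ (Fin p)) with hP
  have hid : Integrable (fun ξ : EuclideanSpace ℝ (Fin p) => ξ) P :=
    ProbabilityTheory.IsGaussian.integrable_id
  have hb : ∀ ξ, |f (x + μ • ξ) - f x| ≤ D * μ * ‖ξ‖ := fun ξ => by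
    have := hlip.dist_le_mul (x + μ • ξ) x
    rw [Real.dist_eq, dist_eq_norm, add_sub_cancel_left, norm_smul, Real.norm_of_nonneg hμ.le,
      Real.coe_toNNReal _ hD] at this
    linarith
  have hc : Continuous fun ξ => f (x + μ • ξ) := hlip.continuous.comp (by fun_prop)
  have hsub : Integrable (fun ξ => f (x + μ • ξ) - f x) P :=
    (hid.norm.const_mul (D * μ)).mono' (hc.sub continuous_const).aestronglyMeasurable
      (Filter.Eventually.of_forall hb)
  have hint : Integrable (fun ξ => f (x + μ • ξ)) P := by
    refine (hsub.add (integrable_const (f x))).congr (Filter.Eventually.of_forall fun ξ => ?_)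
    simp
  constructor
  · have hsm : Integrable (fun ξ => μ • ξ) P := hid.smul μ
    have hlin : Integrable (fun ξ => x + μ • ξ) P := (integrable_const x).add hsm
    have := hconv.map_integral_le hlip.continuous.continuousOn isClosed_univ
      (Filter.Eventually.of_forall fun _ => Set.mem_univ _) hlin hint
    rw [integral_add (integrable_const x) hsm, integral_smul,
      ProbabilityTheory.integral_id_stdGaussian] at this
    simpa using this
  · calc ∫ ξ, f (x + μ • ξ) ∂P ≤ ∫ ξ, (f x + D * μ * ‖ξ‖) ∂P := by
          refine integral_mono hint ((integrable_const _).add (hid.norm.const_mul _)) fun ξ => ?_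
          have := (abs_le.1 (hb ξ)).2
          simp only
          linarith
      _ = f x + D * μ * ∫ ξ, ‖ξ‖ ∂P := by
          rw [integral_add (integrable_const _) (hid.norm.const_mul _), integral_const_mul]
          simp
      _ ≤ f x + D * μ * Real.sqrt p := by
          gcongr
          exact integral_norm_le p
      _ = _ := by ring
end

section
/- Let p ≥ 1 be an integer, let μ > 0 and D ≥ 0, and let f : ℝ^p → ℝ be convex and D-Lipschitz. Then for every x ∈ ℝ^p, the Gaussian smoothing f_μ is differentiable at x, and its gradient is given by ∇f_μ(x) = ∫ ((f(x + μ ξ) − f(x))/μ) · ξ dγ_p(ξ). -/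
open MeasureTheory Real

theorem gs_integrable_exp (p : ℕ) :
    Integrable (fun η : EuclideanSpace ℝ (Fin p) => Real.exp (-(1/8) * ‖η‖ ^ 2)) := by
  have h := GaussianFourier.integrable_cexp_neg_mul_sq_norm_add
    (V := EuclideanSpace ℝ (Fin p)) (b := ((1/8 : ℝ) : ℂ)) (by norm_num) 0 0
  have h2 := h.norm
  refine h2.congr (Filter.Eventually.of_forall fun η => ?_)
  simp only [Complex.norm_exp]
  congr 1
  simp [← Complex.ofReal_pow]

theorem gs_bound (t : ℝ) :
    (1 + t) * (1 + t) * Real.exp (-(t ^ 2 / 4)) ≤ Real.exp 8 * Real.exp (-(1/8) * t ^ 2) ∨ t < 0 := by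
  by_cases ht : t < 0
  · exact Or.inr ht
  left
  push Not at ht
  have h1 : 1 + t ≤ Real.exp t := by linarith [Real.add_one_le_exp t]
  calc (1 + t) * (1 + t) * Real.exp (-(t ^ 2 / 4))
      ≤ Real.exp t * Real.exp t * Real.exp (-(t ^ 2 / 4)) := by gcongr
    _ = Real.exp (t + t + -(t ^ 2 / 4)) := by rw [Real.exp_add, Real.exp_add]
    _ ≤ Real.exp (8 + -(1/8) * t ^ 2) := by
        apply Real.exp_le_exp.2
        nlinarith [sq_nonneg (t - 8)]
    _ = _ := by rw [Real.exp_add]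

theorem gs_main_bound {E : Type*} [NormedAddCommGroup E] (η u : E)
    (hu : ‖u‖ ≤ 1) (v A : ℝ) (hA : 0 ≤ A) (hv : |v| ≤ A * (1 + ‖η‖)) :
    |v| * Real.exp (-‖η - u‖ ^ 2 / 2) * (1 + ‖η‖) ≤
      A * Real.exp 9 * Real.exp (-(1/8) * ‖η‖ ^ 2) := by
  have h0 := norm_nonneg η
  have h1 : -‖η - u‖ ^ 2 / 2 ≤ 1 + -(‖η‖ ^ 2 / 4) := by
    have h2 : ‖η‖ ≤ ‖η - u‖ + 1 := by
      have := norm_add_le (η - u) u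
      simp only [sub_add_cancel] at this
      linarith
    nlinarith [sq_nonneg (‖η - u‖ - 1), norm_nonneg (η - u)]
  have hb := (gs_bound ‖η‖).resolve_right (not_lt.2 h0)
  calc |v| * Real.exp (-‖η - u‖ ^ 2 / 2) * (1 + ‖η‖)
      ≤ (A * (1 + ‖η‖)) * Real.exp (1 + -(‖η‖ ^ 2 / 4)) * (1 + ‖η‖) := by gcongr
    _ = A * Real.exp 1 * ((1 + ‖η‖) * (1 + ‖η‖) * Real.exp (-(‖η‖ ^ 2 / 4))) := by
        rw [Real.exp_add]; ring
    _ ≤ A * Real.exp 1 * (Real.exp 8 * Real.exp (-(1/8) * ‖η‖ ^ 2)) := by gcongr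
    _ = _ := by
        rw [show (9:ℝ) = 1 + 8 by norm_num, Real.exp_add]; ring

theorem gs_hasFDerivAt (p : ℕ) (φ : EuclideanSpace ℝ (Fin p) → ℝ) (hφ : Continuous φ)
    (A : ℝ) (hA : 0 ≤ A) (hb : ∀ η, |φ η| ≤ A * (1 + ‖η‖)) :
    Integrable (fun η => (φ η * Real.exp (-‖η‖ ^ 2 / 2)) • η) ∧
    HasFDerivAt (fun u => ∫ η, φ η * Real.exp (-‖η - u‖ ^ 2 / 2))
      (innerSL ℝ (∫ η, (φ η * Real.exp (-‖η‖ ^ 2 / 2)) • η)) 0 := by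
  have hbd : Integrable (fun η : EuclideanSpace ℝ (Fin p) =>
      A * Real.exp 9 * Real.exp (-(1/8) * ‖η‖ ^ 2)) := (gs_integrable_exp p).const_mul _
  have hint : Integrable (fun η => (φ η * Real.exp (-‖η‖ ^ 2 / 2)) • η) := by
    refine hbd.mono' (by fun_prop) (Filter.Eventually.of_forall fun η => ?_)
    have := gs_main_bound η 0 (by simp) (φ η) A hA (hb η)
    rw [sub_zero] at this
    refine le_trans ?_ this
    rw [norm_smul, norm_mul, Real.norm_eq_abs, Real.norm_eq_abs, Real.abs_exp]
    gcongr
    linarith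
  refine ⟨hint, ?_⟩
  have key := hasFDerivAt_integral_of_dominated_of_fderiv_le (𝕜 := ℝ)
    (μ := (volume : Measure (EuclideanSpace ℝ (Fin p))))
    (F := fun u η => φ η * Real.exp (-‖η - u‖ ^ 2 / 2))
    (F' := fun u η => (φ η * Real.exp (-‖η - u‖ ^ 2 / 2)) • innerSL ℝ (η - u))
    (x₀ := (0 : EuclideanSpace ℝ (Fin p)))
    (bound := fun η => A * Real.exp 9 * Real.exp (-(1/8) * ‖η‖ ^ 2))
    (s := Metric.ball 0 1) (Metric.ball_mem_nhds _ one_pos)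
    (Filter.Eventually.of_forall fun u => by fun_prop)
    (by
      refine hbd.mono' (by fun_prop) (Filter.Eventually.of_forall fun η => ?_)
      refine le_trans ?_ (gs_main_bound η 0 (by simp) (φ η) A hA (hb η))
      rw [norm_mul, Real.norm_eq_abs, Real.norm_eq_abs, Real.abs_exp]
      refine le_mul_of_one_le_right (by positivity) ?_
      linarith [norm_nonneg η])
    (by fun_prop)
    (Filter.Eventually.of_forall fun η u hu => by
      have hu' : ‖u‖ ≤ 1 := by simpa using (Metric.mem_ball.1 hu).le
      refine le_trans ?_ (gs_main_bound η u hu' (φ η) A hA (hb η))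
      rw [norm_smul, norm_mul, Real.norm_eq_abs, Real.norm_eq_abs, Real.abs_exp, innerSL_apply_norm]
      gcongr
      linarith [norm_sub_le η u])
    hbd
    (Filter.Eventually.of_forall fun η u hu => by
      have h1 : HasFDerivAt (fun u => η - u)
          (-ContinuousLinearMap.id ℝ (EuclideanSpace ℝ (Fin p))) u := (hasFDerivAt_id u).const_sub η
      have h2 := ((h1.norm_sq.neg.mul_const (1/2)).exp).const_mul (φ η)
      refine (h2.congr_fderiv ?_).congr_of_eventuallyEq (Filter.Eventually.of_forall fun w => ?_)
      · ext w
        simp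
        ring_nf
      · simp only
        congr 2
        simp [div_eq_mul_inv])
  refine key.congr_fderiv ?_
  have := (innerSL ℝ : EuclideanSpace ℝ (Fin p) →L[ℝ] _).integral_comp_comm hint
  rw [← this]
  simp

theorem gs_integral (p : ℕ) {E : Type*} [NormedAddCommGroup E] [NormedSpace ℝ E]
    (g : EuclideanSpace ℝ (Fin p) → E) :
    ∫ ξ, g ξ ∂(stdGaussian p) =
      (2 * π) ^ (-(p : ℝ) / 2) • ∫ ξ, Real.exp (-‖ξ‖ ^ 2 / 2) • g ξ := by
  unfold stdGaussian
  rw [integral_withDensity_eq_integral_toReal_smul (by fun_prop)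
    (Filter.Eventually.of_forall fun _ => ENNReal.ofReal_lt_top), ← integral_smul]
  refine integral_congr_ae (Filter.Eventually.of_forall fun ξ => ?_)
  simp only
  rw [ENNReal.toReal_ofReal (by positivity), mul_smul]

theorem gaussian_smoothing_hasGradient (p : ℕ) (hp : 1 ≤ p) (μ D : ℝ) (hμ : 0 < μ) (hD : 0 ≤ D)
    (f : EuclideanSpace ℝ (Fin p) → ℝ)
    (hconv : ConvexOn ℝ Set.univ f) (hlip : LipschitzWith D.toNNReal f)
    (x : EuclideanSpace ℝ (Fin p)) :
    HasGradientAt (fun y => ∫ ξ, f (y + μ • ξ) ∂(stdGaussian p))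
      (∫ ξ, ((f (x + μ • ξ) - f x) / μ) • ξ ∂(stdGaussian p)) x := by
  have hf := hlip.continuous
  have hA : 0 ≤ |f x| + D * μ := by positivity
  obtain ⟨hi, hd⟩ := gs_hasFDerivAt p (fun η => f (x + μ • η)) (by fun_prop) (|f x| + D * μ) hA
    (fun η => by
      have h1 := hlip.dist_le_mul (x + μ • η) x
      rw [Real.dist_eq, dist_eq_norm, add_sub_cancel_left, norm_smul, Real.norm_eq_abs,
        abs_of_pos hμ, Real.coe_toNNReal _ hD] at h1
      have h2 := abs_sub_abs_le_abs_sub (f (x + μ • η)) (f x)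
      have h3 : 0 ≤ |f x| * ‖η‖ := by positivity
      have h4 : 0 ≤ D * μ := by positivity
      nlinarith)
  obtain ⟨hi2, -⟩ := gs_hasFDerivAt p (fun _ => f x) (by fun_prop) (|f x|) (abs_nonneg _)
    (fun η => by nlinarith [abs_nonneg (f x), norm_nonneg η])
  have hodd : ∫ η : EuclideanSpace ℝ (Fin p), (f x * Real.exp (-‖η‖ ^ 2 / 2)) • η = 0 := by
    have h := integral_neg_eq_self
      (fun η : EuclideanSpace ℝ (Fin p) => (f x * Real.exp (-‖η‖ ^ 2 / 2)) • η) volume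
    simp only [norm_neg, smul_neg, integral_neg] at h
    have : IsAddTorsionFree (EuclideanSpace ℝ (Fin p)) := .of_isTorsionFree ℝ _
    exact self_eq_neg.1 h.symm
  have hF : (fun y => ∫ ξ, f (y + μ • ξ) ∂(stdGaussian p)) = fun y =>
      (2 * π) ^ (-(p : ℝ) / 2) *
        (fun u => ∫ η, f (x + μ • η) * Real.exp (-‖η - u‖ ^ 2 / 2)) (μ⁻¹ • (y - x)) := by
    ext y
    rw [gs_integral, smul_eq_mul]
    congr 1
    simp only
    rw [← integral_sub_right_eq_self (fun ξ => Real.exp (-‖ξ‖ ^ 2 / 2) • f (y + μ • ξ))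
      (μ⁻¹ • (y - x))]
    refine integral_congr_ae (Filter.Eventually.of_forall fun ξ => ?_)
    simp only [smul_eq_mul]
    rw [mul_comm, smul_sub, smul_inv_smul₀ hμ.ne']
    congr 2
    abel
  have hG : (∫ ξ, ((f (x + μ • ξ) - f x) / μ) • ξ ∂(stdGaussian p)) =
      ((2 * π) ^ (-(p : ℝ) / 2) * μ⁻¹) •
        ∫ η, (f (x + μ • η) * Real.exp (-‖η‖ ^ 2 / 2)) • η := by
    rw [gs_integral, mul_smul]
    congr 1
    rw [← sub_zero (∫ η, (f (x + μ • η) * Real.exp (-‖η‖ ^ 2 / 2)) • η), ← hodd,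
      ← integral_sub hi hi2, ← integral_smul]
    refine integral_congr_ae (Filter.Eventually.of_forall fun ξ => ?_)
    simp only
    rw [← sub_smul, smul_smul, smul_smul]
    congr 1
    ring
  rw [hF, hG, hasGradientAt_iff_hasFDerivAt]
  have hs : HasFDerivAt (fun y : EuclideanSpace ℝ (Fin p) => μ⁻¹ • (y - x))
      (μ⁻¹ • ContinuousLinearMap.id ℝ _) x := ((hasFDerivAt_id x).sub_const x).const_smul μ⁻¹
  have hd' : HasFDerivAt (fun u => ∫ η, f (x + μ • η) * Real.exp (-‖η - u‖ ^ 2 / 2))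
      (innerSL ℝ (∫ η, (f (x + μ • η) * Real.exp (-‖η‖ ^ 2 / 2)) • η)) (μ⁻¹ • (x - x)) := by
    rw [sub_self, smul_zero]; exact hd
  refine ((hd'.comp x hs).const_mul _).congr_fderiv ?_
  ext w
  simp
  ring
end

section
/- Let p ≥ 1 be an integer, let μ > 0 and D ≥ 0, and let f : ℝ^p → ℝ be D-Lipschitz. Then for every x ∈ ℝ^p, the second moment of the two-point gradient oracle is bounded as ∫ ‖((f(x + μ ξ) − f(x))/μ) · ξ‖² dγ_p(ξ) ≤ (p + 4)² D². -/
open MeasureTheory Real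

theorem radial_fourth_moment (p : ℕ) (hp : 1 ≤ p) :
    ∫ y in Set.Ioi (0 : ℝ), y ^ (p - 1) •
      (((2 * π) ^ (-(p : ℝ) / 2) * Real.exp (-y ^ 2 / 2)) * y ^ 4) =
    (2 * π) ^ (-(p : ℝ) / 2) *
      ((1 / 2 : ℝ) ^ (-((p : ℝ) + 3 + 1) / 2) * (1 / 2) * Real.Gamma (((p : ℝ) + 3 + 1) / 2)) := by
  rw [← integral_rpow_mul_exp_neg_mul_rpow (by norm_num) (by linarith [p.cast_nonneg (α := ℝ)]) (by norm_num),
    ← integral_const_mul]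
  refine setIntegral_congr_fun measurableSet_Ioi fun y hy => ?_
  have h1 : y ^ ((p : ℝ) + 3) = y ^ (p - 1) * y ^ 4 := by
    rw [← pow_add, ← Real.rpow_natCast]
    congr 1
    rw [show p - 1 + 4 = p + 3 by omega]
    push_cast
    ring
  have h2 : y ^ (2 : ℝ) = y ^ 2 := Real.rpow_two y
  simp only [smul_eq_mul, h1, h2]
  rw [show -y ^ 2 / 2 = -(1 / 2) * y ^ 2 by ring]
  ring

theorem stdGaussian_fourth_moment (p : ℕ) (hp : 1 ≤ p) :
    ∫ ξ, ‖ξ‖ ^ 4 ∂(stdGaussian p) = (p : ℝ) * (p + 2) := by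
  have : Nonempty (Fin p) := ⟨⟨0, hp⟩⟩
  have hpr : (0 : ℝ) < p := by exact_mod_cast hp
  unfold stdGaussian
  rw [integral_withDensity_eq_integral_toReal_smul (by fun_prop) (by simp)]
  have h0 : ∀ ξ : EuclideanSpace ℝ (Fin p),
      (ENNReal.ofReal ((2 * π) ^ (-(p : ℝ) / 2) * Real.exp (-‖ξ‖ ^ 2 / 2))).toReal • ‖ξ‖ ^ 4 =
      (fun y : ℝ => ((2 * π) ^ (-(p : ℝ) / 2) * Real.exp (-y ^ 2 / 2)) * y ^ 4) ‖ξ‖ := by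
    intro ξ
    rw [ENNReal.toReal_ofReal (by positivity), smul_eq_mul]
  rw [integral_congr_ae (.of_forall h0), integral_fun_norm_addHaar volume
    (fun y : ℝ => ((2 * π) ^ (-(p : ℝ) / 2) * Real.exp (-y ^ 2 / 2)) * y ^ 4)]
  simp only [finrank_euclideanSpace, Fintype.card_fin]
  rw [radial_fourth_moment p hp, Measure.real, EuclideanSpace.volume_ball]
  have hG : 0 < Real.Gamma ((p : ℝ) / 2 + 1) := Real.Gamma_pos_of_pos (by positivity)
  have hG2 : Real.Gamma (((p : ℝ) + 3 + 1) / 2) = (p / 2 + 1) * Real.Gamma ((p : ℝ) / 2 + 1) := by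
    rw [← Real.Gamma_add_one (by positivity)]
    congr 1
    ring
  have hpi : √π ^ p = π ^ ((p : ℝ) / 2) := by
    rw [Real.sqrt_eq_rpow, ← Real.rpow_natCast, ← Real.rpow_mul pi_pos.le]
    congr 1
    ring
  have h2 : (1 / 2 : ℝ) ^ (-((p : ℝ) + 3 + 1) / 2) = 2 ^ ((p : ℝ) / 2) * 4 := by
    rw [one_div, Real.inv_rpow (by norm_num), ← Real.rpow_neg (by norm_num),
      show -(-((p : ℝ) + 3 + 1) / 2) = p / 2 + 2 by ring, Real.rpow_add (by norm_num)]
    norm_num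
  have h3 : (2 * π) ^ (-(p : ℝ) / 2) = (2 ^ ((p : ℝ) / 2))⁻¹ * (π ^ ((p : ℝ) / 2))⁻¹ := by
    rw [Real.mul_rpow (by norm_num) pi_pos.le, neg_div, Real.rpow_neg (by norm_num),
      Real.rpow_neg pi_pos.le]
  have a1 : (0 : ℝ) < 2 ^ ((p : ℝ) / 2) := by positivity
  have a2 : (0 : ℝ) < π ^ ((p : ℝ) / 2) := by positivity
  rw [hG2, h2, h3]
  simp only [Fintype.card_fin, hpi, ENNReal.ofReal_one, one_pow, one_mul, nsmul_eq_mul, smul_eq_mul]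
  rw [ENNReal.toReal_ofReal (by positivity)]
  field_simp
  ring

theorem oracle_second_moment_bound (p : ℕ) (hp : 1 ≤ p) (μ D : ℝ) (hμ : 0 < μ) (hD : 0 ≤ D)
    (f : EuclideanSpace ℝ (Fin p) → ℝ) (hlip : LipschitzWith D.toNNReal f)
    (x : EuclideanSpace ℝ (Fin p)) :
    ∫ ξ, ‖((f (x + μ • ξ) - f x) / μ) • ξ‖ ^ 2 ∂(stdGaussian p) ≤ ((p : ℝ) + 4) ^ 2 * D ^ 2 := by
  have hpr : (0 : ℝ) < p := by exact_mod_cast hp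
  have hm := stdGaussian_fourth_moment p hp
  have hint : Integrable (fun ξ => ‖ξ‖ ^ 4) (stdGaussian p) :=
    .of_integral_ne_zero (by rw [hm]; positivity)
  have hle : ∫ ξ, ‖((f (x + μ • ξ) - f x) / μ) • ξ‖ ^ 2 ∂(stdGaussian p) ≤
      ∫ ξ, D ^ 2 * ‖ξ‖ ^ 4 ∂(stdGaussian p) := by
    refine integral_mono_of_nonneg (.of_forall fun ξ => by positivity) (hint.const_mul _)
      (.of_forall fun ξ => ?_)
    have h1 : ‖f (x + μ • ξ) - f x‖ ≤ D * (μ * ‖ξ‖) := by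
      have := hlip.norm_sub_le (x + μ • ξ) x
      rwa [add_sub_cancel_left, norm_smul, Real.norm_of_nonneg hμ.le, Real.coe_toNNReal D hD] at this
    have h2 : ‖(f (x + μ • ξ) - f x) / μ‖ ≤ D * ‖ξ‖ := by
      rw [norm_div, Real.norm_of_nonneg hμ.le, div_le_iff₀ hμ]
      linarith
    calc ‖((f (x + μ • ξ) - f x) / μ) • ξ‖ ^ 2
        = (‖(f (x + μ • ξ) - f x) / μ‖ * ‖ξ‖) ^ 2 := by rw [norm_smul]
      _ ≤ ((D * ‖ξ‖) * ‖ξ‖) ^ 2 := by gcongr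
      _ = D ^ 2 * ‖ξ‖ ^ 4 := by ring
  rw [integral_const_mul, hm] at hle
  nlinarith [sq_nonneg D, mul_nonneg hpr.le (sq_nonneg D)]
end

section
/- Let p ≥ 1 be an integer, let μ > 0 and D ≥ 0, and let f : ℝ^p → ℝ be D-Lipschitz. Then for every x ∈ ℝ^p, the first moment of the two-point gradient oracle is bounded as ∫ ‖((f(x + μ ξ) − f(x))/μ) · ξ‖ dγ_p(ξ) ≤ (p + 4) D. -/
open MeasureTheory Real

lemma oracle_aux_density (p : ℕ) (y : Fin p → ℝ) :
    (2 * π) ^ (-(p : ℝ) / 2) * Real.exp (-‖WithLp.toLp 2 y‖ ^ 2 / 2)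
      = ∏ i, ProbabilityTheory.gaussianPDFReal 0 1 (y i) := by
  simp only [ProbabilityTheory.gaussianPDFReal_def, Finset.prod_mul_distrib, ← Real.exp_sum]
  congr 1
  · have h : (0 : ℝ) ≤ 2 * π := by positivity
    simp only [NNReal.coe_one, mul_one, Finset.prod_const, Finset.card_univ, Fintype.card_fin]
    rw [Real.sqrt_eq_rpow, ← Real.rpow_neg h, ← Real.rpow_natCast, ← Real.rpow_mul h]
    congr 1
    ring
  · rw [EuclideanSpace.norm_sq_eq]
    simp [Finset.sum_div, neg_div]

lemma oracle_aux_one_int :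
    Integrable (fun t : ℝ => t ^ 2 * ProbabilityTheory.gaussianPDFReal 0 1 t) := by
  have h := (ProbabilityTheory.memLp_id_gaussianReal (μ := 0) (v := 1) 2).integrable_sq
  rw [ProbabilityTheory.gaussianReal_of_var_ne_zero _ one_ne_zero,
    integrable_withDensity_iff (ProbabilityTheory.measurable_gaussianPDF _ _)
      (ae_of_all _ fun _ => ProbabilityTheory.gaussianPDF_lt_top)] at h
  simpa using h

lemma oracle_aux_one_val :
    ∫ t : ℝ, t ^ 2 * ProbabilityTheory.gaussianPDFReal 0 1 t = 1 := by
  have h := ProbabilityTheory.variance_id_gaussianReal (μ := 0) (v := 1)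
  rw [ProbabilityTheory.variance_eq_integral (by fun_prop)] at h
  simp only [id, ProbabilityTheory.integral_id_gaussianReal, sub_zero] at h
  rw [ProbabilityTheory.integral_gaussianReal_eq_integral_smul one_ne_zero] at h
  simpa [mul_comm] using h

lemma oracle_aux_term (p : ℕ) (i : Fin p) :
    Integrable (fun y : Fin p → ℝ =>
        y i ^ 2 * ∏ j, ProbabilityTheory.gaussianPDFReal 0 1 (y j)) ∧
      ∫ y : Fin p → ℝ, y i ^ 2 * ∏ j, ProbabilityTheory.gaussianPDFReal 0 1 (y j) = 1 := by
  let F : Fin p → ℝ → ℝ := fun j t =>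
    (if j = i then t ^ 2 else 1) * ProbabilityTheory.gaussianPDFReal 0 1 t
  have hF : (fun y : Fin p → ℝ => y i ^ 2 * ∏ j, ProbabilityTheory.gaussianPDFReal 0 1 (y j))
      = fun y => ∏ j, F j (y j) := by
    funext y
    simp only [F]
    rw [Finset.prod_mul_distrib]
    simp
  constructor
  · rw [hF]
    refine Integrable.fintype_prod fun j => ?_
    by_cases hj : j = i
    · simpa [F, hj] using oracle_aux_one_int
    · simpa [F, hj] using ProbabilityTheory.integrable_gaussianPDFReal 0 1
  · rw [hF, integral_fintype_prod_volume_eq_prod]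
    refine Finset.prod_eq_one fun j _ => ?_
    by_cases hj : j = i
    · simpa [F, hj] using oracle_aux_one_val
    · simpa [F, hj] using ProbabilityTheory.integral_gaussianPDFReal_eq_one 0 one_ne_zero

lemma oracle_aux_sq (p : ℕ) :
    Integrable (fun ξ : EuclideanSpace ℝ (Fin p) => ‖ξ‖ ^ 2) (stdGaussian p) ∧
      ∫ ξ, ‖ξ‖ ^ 2 ∂(stdGaussian p) = p := by
  have hm : Measurable fun ξ : EuclideanSpace ℝ (Fin p) =>
    ENNReal.ofReal ((2 * π) ^ (-(p : ℝ) / 2) * Real.exp (-‖ξ‖ ^ 2 / 2)) := by fun_prop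
  have he : ∀ y : Fin p → ℝ,
      (ENNReal.ofReal ((2 * π) ^ (-(p : ℝ) / 2) *
        Real.exp (-‖WithLp.toLp 2 y‖ ^ 2 / 2))).toReal • ‖WithLp.toLp 2 y‖ ^ 2
      = ∑ i, y i ^ 2 * ∏ j, ProbabilityTheory.gaussianPDFReal 0 1 (y j) := by
    intro y
    rw [ENNReal.toReal_ofReal (by positivity), oracle_aux_density, EuclideanSpace.norm_sq_eq,
      ← Finset.sum_mul]
    simp [mul_comm]
  have hemb := (MeasurableEquiv.toLp 2 (Fin p → ℝ)).measurableEmbedding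
  unfold stdGaussian
  constructor
  · rw [integrable_withDensity_iff_integrable_smul' hm (ae_of_all _ fun _ => ENNReal.ofReal_lt_top),
      ← (PiLp.volume_preserving_toLp (Fin p)).integrable_comp_emb hemb]
    simp only [Function.comp_def, he]
    exact integrable_finsetSum _ fun i _ => (oracle_aux_term p i).1
  · rw [integral_withDensity_eq_integral_toReal_smul hm
        (ae_of_all _ fun _ => ENNReal.ofReal_lt_top),
      ← (PiLp.volume_preserving_toLp (Fin p)).integral_comp hemb]
    simp only [he]
    rw [integral_finsetSum _ fun i _ => (oracle_aux_term p i).1]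
    simp [(oracle_aux_term p _).2]

theorem oracle_first_moment_bound (p : ℕ) (hp : 1 ≤ p) (μ D : ℝ) (hμ : 0 < μ) (hD : 0 ≤ D)
    (f : EuclideanSpace ℝ (Fin p) → ℝ) (hlip : LipschitzWith D.toNNReal f)
    (x : EuclideanSpace ℝ (Fin p)) :
    ∫ ξ, ‖((f (x + μ • ξ) - f x) / μ) • ξ‖ ∂(stdGaussian p) ≤ ((p : ℝ) + 4) * D := by
  obtain ⟨hi, hv⟩ := oracle_aux_sq p
  calc ∫ ξ, ‖((f (x + μ • ξ) - f x) / μ) • ξ‖ ∂(stdGaussian p)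
      ≤ ∫ ξ, D * ‖ξ‖ ^ 2 ∂(stdGaussian p) := by
        refine integral_mono_of_nonneg (ae_of_all _ fun ξ => norm_nonneg _) (hi.const_mul D)
          (ae_of_all _ fun ξ => ?_)
        have h := hlip.dist_le_mul (x + μ • ξ) x
        rw [Real.coe_toNNReal _ hD, Real.dist_eq, dist_eq_norm, add_sub_cancel_left, norm_smul,
          Real.norm_of_nonneg hμ.le] at h
        have h2 : |f (x + μ • ξ) - f x| / μ ≤ D * ‖ξ‖ := by
          rw [div_le_iff₀ hμ]; linarith
        simp only [norm_smul, Real.norm_eq_abs, abs_div, abs_of_pos hμ]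
        nlinarith [mul_le_mul_of_nonneg_right h2 (norm_nonneg ξ)]
    _ = D * p := by rw [integral_const_mul, hv]
    _ ≤ ((p : ℝ) + 4) * D := by linarith
end
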